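/- Let p be a prime and t, k positive integers. If a symmetric Boolean function f : {0,1}^n → {0,1} satisfies deg_{p^k}(f) ≤ p^t − 1, then f is p^t-periodic. -/

import Mathlib

/-- Hamming weight of a Boolean input. -/
def wt {n : ℕ} (x : Fin n → Bool) : ℕ :=
  (Finset.univ.filter fun i => x i = true).card

/-- Coefficient of the monomial `∏_{i ∈ S} x_i` in the unique multilinear polynomial over
`ℤ_m` representing the Boolean function `f`, obtained by Möbius inversion. -/
def modCoeff (m n : ℕ) (f : (Fin n → Bool) → Bool) (S : Finset (Fin n)) : ZMod m :=
  ∑ T ∈ S.powerset, (-1 : ZMod m) ^ (S.card - T.card) * (if f (fun i => decide (i ∈ T)) then 1 else 0)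

/-- The modulo-`m` degree of a Boolean function: the total degree of the unique multilinear
polynomial over `ℤ_m` representing it. -/
def modDeg (m n : ℕ) (f : (Fin n → Bool) → Bool) : ℕ :=
  ((Finset.univ : Finset (Finset (Fin n))).filter fun S => modCoeff m n f S ≠ 0).sup Finset.card

/-- A Boolean function is symmetric if its value depends only on the Hamming weight. -/
def SymmetricBF {n : ℕ} (f : (Fin n → Bool) → Bool) : Prop :=
  ∀ x y, wt x = wt y → f x = f y

/-- A Boolean function is non-trivial if it is not constant. -/
def NontrivialBF {n : ℕ} (f : (Fin n → Bool) → Bool) : Prop :=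
  ∃ x y, f x ≠ f y

/-- A symmetric Boolean function is `ℓ`-periodic if its univariate version takes equal values
on arguments that agree modulo `ℓ`. -/
def PeriodicBF {n : ℕ} (ℓ : ℕ) (f : (Fin n → Bool) → Bool) : Prop :=
  ∀ x y : Fin n → Bool, wt x % ℓ = wt y % ℓ → f x = f y

/-- A Boolean function is non-degenerate if every coordinate is sensitive on some input. -/
def NondegenerateBF {n : ℕ} (f : (Fin n → Bool) → Bool) : Prop :=
  ∀ i : Fin n, ∃ x, f x ≠ f (Function.update x i (!x i))

/-- The univariate version of `f`, read off on initial segments and valued in a ring `R`. -/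
def univariate {n : ℕ} (R : Type*) [Zero R] [One R] (f : (Fin n → Bool) → Bool) (a : ℕ) : R :=
  if f (fun i => decide ((i : ℕ) < a)) then 1 else 0

theorem wt_le {n : ℕ} (x : Fin n → Bool) : wt x ≤ n :=
  (Finset.card_le_univ _).trans_eq (Fintype.card_fin n)

theorem wt_initial {n a : ℕ} (ha : a ≤ n) :
    wt (fun i : Fin n => decide ((i : ℕ) < a)) = a := by
  simpa [wt] using Fin.card_filter_val_lt.trans (min_eq_right ha)

theorem wt_indicator {n : ℕ} (T : Finset (Fin n)) : wt (fun i => decide (i ∈ T)) = T.card := by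
  simp [wt]

theorem SymmetricBF.eq_initial {n : ℕ} {f : (Fin n → Bool) → Bool} (hf : SymmetricBF f)
    (x : Fin n → Bool) : f x = f (fun i => decide ((i : ℕ) < wt x)) :=
  hf _ _ (wt_initial (wt_le x)).symm

/-- For symmetric `f`, the coefficients are the iterated forward differences at `0`. -/
theorem SymmetricBF.modCoeff_eq_fwdDiff {m n : ℕ} {f : (Fin n → Bool) → Bool}
    (hf : SymmetricBF f) (S : Finset (Fin n)) :
    modCoeff m n f S = (fwdDiff 1)^[S.card] (univariate (ZMod m) f) 0 := by
  have h : modCoeff m n f S = ∑ T ∈ S.powerset,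
      (-1 : ZMod m) ^ (S.card - T.card) * univariate (ZMod m) f T.card := by
    refine Finset.sum_congr rfl fun T _ => ?_
    rw [hf.eq_initial, wt_indicator, univariate]
  rw [h, Finset.sum_powerset_apply_card
    (fun j => (-1 : ZMod m) ^ (S.card - j) * univariate (ZMod m) f j), fwdDiff_iter_eq_sum_shift]
  refine Finset.sum_congr rfl fun j _ => ?_
  simp [nsmul_eq_mul, zsmul_eq_mul]
  ring

theorem modCoeff_eq_zero_of_modDeg_lt {m n : ℕ} {f : (Fin n → Bool) → Bool}
    {S : Finset (Fin n)} (h : modDeg m n f < S.card) : modCoeff m n f S = 0 := by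
  by_contra hS
  exact h.not_ge (Finset.le_sup (f := Finset.card) (by simpa using hS))

theorem castHom_modCoeff {m d n : ℕ} (h : d ∣ m) (f : (Fin n → Bool) → Bool)
    (S : Finset (Fin n)) : ZMod.castHom h (ZMod d) (modCoeff m n f S) = modCoeff d n f S := by
  simp only [modCoeff, map_sum, map_mul, map_pow, map_neg, map_one, map_zero, apply_ite]

/-- In characteristic `p`, the `p ^ t`-th iterated difference is the difference with step `p ^ t`. -/
theorem fwdDiff_iter_prime_pow {R : Type*} [CommRing R] (p : ℕ) [Fact p.Prime] [CharP R p]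
    (t : ℕ) (F : ℕ → R) (a : ℕ) :
    (fwdDiff 1)^[p ^ t] F a = F (a + p ^ t) - F a := by
  have hp : p.Prime := Fact.out
  rw [fwdDiff_iter_eq_sum_shift, Finset.sum_range_succ,
    Finset.sum_eq_single_of_mem 0 (Finset.mem_range.2 (pow_pos hp.pos t))]
  · simp [neg_one_pow_char_pow (R := R) (p := p)]
    ring
  · intro j hj hj0
    have : ((p ^ t).choose j : R) = 0 :=
      (CharP.cast_eq_zero_iff R p _).2 (hp.dvd_choose_pow hj0 (Finset.mem_range.1 hj).ne)
    simp [this]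

theorem univariate_add_prime_pow {p t k n : ℕ} [Fact p.Prime] (hk : 0 < k)
    {f : (Fin n → Bool) → Bool} (hsym : SymmetricBF f) (hdeg : modDeg (p ^ k) n f < p ^ t)
    {a : ℕ} (ha : a + p ^ t ≤ n) :
    univariate (ZMod p) f (a + p ^ t) = univariate (ZMod p) f a := by
  rw [← sub_eq_zero, ← fwdDiff_iter_prime_pow p t]
  have key := shift_eq_sum_fwdDiff_iter (1 : ℕ) ((fwdDiff 1)^[p ^ t] (univariate (ZMod p) f)) a 0
  rw [zero_add, smul_eq_mul, mul_one] at key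
  rw [key]
  refine Finset.sum_eq_zero fun j hj => ?_
  obtain ⟨S, -, hS⟩ := Finset.exists_subset_card_eq
    (s := (Finset.univ : Finset (Fin n))) (n := j + p ^ t)
    (by rw [Finset.card_fin]; have := Finset.mem_range.1 hj; omega)
  rw [← Function.iterate_add_apply, ← hS, ← hsym.modCoeff_eq_fwdDiff,
    ← castHom_modCoeff (dvd_pow_self p hk.ne'),
    modCoeff_eq_zero_of_modDeg_lt (by omega), map_zero, smul_zero]

theorem univariate_mod_prime_pow {p t k n : ℕ} [Fact p.Prime] (hk : 0 < k)
    {f : (Fin n → Bool) → Bool} (hsym : SymmetricBF f) (hdeg : modDeg (p ^ k) n f < p ^ t)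
    {a : ℕ} (ha : a ≤ n) : univariate (ZMod p) f a = univariate (ZMod p) f (a % p ^ t) := by
  induction a using Nat.strong_induction_on with
  | _ a ih =>
    rcases lt_or_ge a (p ^ t) with h | h
    · rw [Nat.mod_eq_of_lt h]
    · obtain ⟨b, rfl⟩ := Nat.exists_eq_add_of_le' h
      rw [univariate_add_prime_pow hk hsym hdeg ha, Nat.add_mod_right]
      exact ih b (by omega) (by omega)

/-- If a symmetric Boolean function has `deg_{p^k}(f) ≤ p^t − 1`, then it is
`p^t`-periodic. -/
theorem stmt4 (p t k n : ℕ) (hp : p.Prime) (ht : 0 < t) (hk : 0 < k)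
    (f : (Fin n → Bool) → Bool) (hsym : SymmetricBF f)
    (hdeg : modDeg (p ^ k) n f ≤ p ^ t - 1) :
    PeriodicBF (p ^ t) f := by
  have := Fact.mk hp
  have hlt : modDeg (p ^ k) n f < p ^ t := by have := pow_pos hp.pos t; omega
  intro x y hxy
  have h : univariate (ZMod p) f (wt x) = univariate (ZMod p) f (wt y) := by
    rw [univariate_mod_prime_pow hk hsym hlt (wt_le x),
      univariate_mod_prime_pow hk hsym hlt (wt_le y), hxy]
  rw [univariate, univariate, ← hsym.eq_initial, ← hsym.eq_initial] at h
  cases hx : f x <;> cases hy : f y <;> simp_all
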